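/- arXiv:2509.23447 — 11 statements merged into one kernel-verified Lean document; each statement's English description precedes it below -/
import Mathlib

section
/- Let F_q be a finite field, and let K, L, M be positive integers with L ≤ K and M ≤ K. Set R = min( K, L·⌈K/(L+M−1)⌉ ). Then for every matrix D ∈ F_q^{L×K} there exist matrices C ∈ F_q^{L×R} and A ∈ F_q^{R×K} such that D = C·A and every row of A has at most M nonzero entries. (Theorem 1: the rate R_1(K,L,M) = min{K, L⌈K/(L+M−1)⌉} is achievable for the (K,L,M) distributed linearly separable function computation problem.) -/
/-- Among finitely many vectors in a space of dimension at most `L`, some `min L s.card` of them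
span all the others. -/
theorem exists_subset_card_eq_min_subset_span {F V ι : Type*} [Field F] [AddCommGroup V]
    [Module F V] [FiniteDimensional F V] {L : ℕ} (hV : Module.finrank F V ≤ L)
    (v : ι → V) (s : Finset ι) :
    ∃ S ⊆ s, S.card = min L s.card ∧ ∀ j ∈ s, v j ∈ Submodule.span F (v '' (S : Set ι)) := by
  classical
  obtain ⟨b, hbs, -, hspan, hli⟩ := exists_linearIndepOn_extension (K := F) (v := v)
    (linearIndepOn_empty F v) (Set.empty_subset (s : Set ι))
  obtain ⟨b, rfl⟩ := (s.finite_toSet.subset hbs).exists_finset_coe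
  have hbs' : b ⊆ s := by exact_mod_cast hbs
  have hcard : b.card ≤ L := by
    have h := LinearIndependent.fintype_card_le_finrank hli
    simp only [Finset.coe_sort_coe, Fintype.card_coe] at h
    exact h.trans hV
  obtain ⟨S, hbS, hSs, hS⟩ := Finset.exists_subsuperset_card_eq hbs'
    (le_min hcard (Finset.card_le_card hbs')) (min_le_right L s.card)
  refine ⟨S, hSs, hS, fun j hj => ?_⟩
  exact Submodule.span_mono (Set.image_mono (by exact_mod_cast hbS))
    (hspan (Set.mem_image_of_mem v (by exact_mod_cast hj)))

/-- If the columns are partitioned by `f` into `B` blocks of size at most `L + M - 1`, then `D`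
factors through at most `L * B` of its own columns with an `M`-sparse right factor. -/
theorem exists_mul_eq_self_of_fiber_card_le {F ι : Type*} [Field F] [DecidableEq F] [Fintype ι]
    [DecidableEq ι] {L M B : ℕ} (hM : 0 < M) (D : Matrix (Fin L) ι F) (f : ι → Fin B)
    (hf : ∀ b, (Finset.univ.filter fun j => f j = b).card ≤ L + M - 1) :
    ∃ (S : Finset ι) (A : Matrix ι ι F), S.card ≤ L * B ∧ D = D * A ∧
      (∀ i ∉ S, ∀ j, A i j = 0) ∧
      ∀ i, (Finset.univ.filter fun j => A i j ≠ 0).card ≤ M := by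
  choose T hTs hTcard hTspan using fun b : Fin B =>
    exists_subset_card_eq_min_subset_span (F := F) (L := L) (by simp) D.col
      (Finset.univ.filter fun j => f j = b)
  have hTf : ∀ {b i}, i ∈ T b → f i = b := fun h => by simpa using hTs _ h
  have hcoef : ∀ j, ∃ a : ι → F, (∀ i ∉ T (f j), a i = 0) ∧ (∑ i, a i • D.col i = D.col j) ∧
      (j ∈ T (f j) → ∀ i, i ≠ j → a i = 0) := by
    intro j
    by_cases hj : j ∈ T (f j)
    · refine ⟨Pi.single j 1, fun i hi => ?_, ?_, fun _ i hi => by simp [hi]⟩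
      · have : i ≠ j := fun h => hi (h ▸ hj)
        simp [this]
      · simp [Pi.single_apply, ite_smul]
    · obtain ⟨c, hc⟩ := (Submodule.mem_span_image_finset_iff_exists_fun' F).1
        (hTspan (f j) j (by simp))
      refine ⟨fun i => if i ∈ T (f j) then c i else 0, fun i hi => by simp [hi], ?_,
        fun h => absurd h hj⟩
      simpa [ite_smul, Finset.sum_ite_mem] using hc
  choose a ha0 hasum hasingle using hcoef
  refine ⟨Finset.univ.biUnion T, Matrix.of fun i j => a j i, ?_, ?_, ?_, ?_⟩
  · calc (Finset.univ.biUnion T).card ≤ (Finset.univ : Finset (Fin B)).card * L :=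
          Finset.card_biUnion_le_card_mul _ _ _ fun b _ => (hTcard b).trans_le (min_le_left _ _)
      _ = L * B := by simp [mul_comm]
  · ext l j
    have h := congrFun (hasum j) l
    simp only [Finset.sum_apply, Pi.smul_apply, Matrix.col_apply, smul_eq_mul] at h
    simp only [Matrix.mul_apply, Matrix.of_apply, ← h, mul_comm]
  · intro i hi j
    exact ha0 j i fun h => hi (Finset.mem_biUnion.2 ⟨_, Finset.mem_univ _, h⟩)
  · intro i
    have hsub : (Finset.univ.filter fun j => Matrix.of (fun i j => a j i) i j ≠ 0) ⊆
        insert i ((Finset.univ.filter fun j => f j = f i) \ T (f i)) := by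
      intro j hj
      replace hj : a j i ≠ 0 := (Finset.mem_filter.1 hj).2
      have hi : i ∈ T (f j) := by by_contra h; exact hj (ha0 j i h)
      have hfij := hTf hi
      simp only [Finset.mem_insert, Finset.mem_sdiff, Finset.mem_filter, Finset.mem_univ, true_and]
      by_contra! h
      exact hj (hasingle j (hfij ▸ h.2 hfij.symm) i (Ne.symm h.1))
    refine (Finset.card_le_card hsub).trans ((Finset.card_insert_le _ _).trans ?_)
    rw [Finset.card_sdiff_of_subset (hTs _), hTcard]
    have := hf (f i)
    omega


/-- Theorem 1: Over any finite field, with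
`R = min(K, L·⌈K/(L+M−1)⌉)`, every `D ∈ F_q^{L×K}` factors as `D = C·A`
where every row of `A` has at most `M` nonzero entries. -/
theorem scheme1_rate_achievable
    (F : Type*) [Field F] [Fintype F] [DecidableEq F]
    (K L M : ℕ) (hK : 0 < K) (hL : 0 < L) (hM : 0 < M)
    (hLK : L ≤ K) (hMK : M ≤ K)
    (R : ℕ) (hR : R = min K (L * ⌈(K : ℚ) / (L + M - 1 : ℕ)⌉₊)) :
    ∀ D : Matrix (Fin L) (Fin K) F,
      ∃ (C : Matrix (Fin L) (Fin R) F) (A : Matrix (Fin R) (Fin K) F),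
        D = C * A ∧
        ∀ r : Fin R, (Finset.univ.filter fun j : Fin K => A r j ≠ 0).card ≤ M := by
  intro D
  set N := L + M - 1 with hN
  have hNpos : 0 < N := by omega
  set B := ⌈(K : ℚ) / (N : ℕ)⌉₊ with hB
  have hKB : K ≤ B * N := by
    have h := Nat.le_ceil ((K : ℚ) / (N : ℕ))
    rw [div_le_iff₀ (by exact_mod_cast hNpos)] at h
    exact_mod_cast h
  obtain ⟨S, A, hScard, hDA, hA0, hAM⟩ := exists_mul_eq_self_of_fiber_card_le hM D
    (fun j : Fin K => (⟨j / N, (Nat.div_lt_iff_lt_mul hNpos).2 (j.2.trans_le hKB)⟩ : Fin B)) (by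
      intro b
      rw [← hN]
      have hmaps : ∀ j ∈ Finset.univ.filter (fun j : Fin K => (j : ℕ) / N = b),
          (j : ℕ) ∈ Finset.Ico (b * N) ((b + 1) * N) := by
        intro j hj
        have hj' : (j : ℕ) / N = b := by simpa using hj
        rw [Finset.mem_Ico, ← hj']
        exact ⟨Nat.div_mul_le_self _ _, by
          rw [add_mul, one_mul]; exact Nat.lt_div_mul_add hNpos⟩
      have h := Finset.card_le_card_of_injOn (fun j : Fin K => (j : ℕ)) hmaps
        Fin.val_injective.injOn
      simpa [Fin.ext_iff, add_mul] using h)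
  have hSR : S.card ≤ R := hR ▸ le_min (by simpa using S.card_le_univ) hScard
  obtain ⟨S', hSS', -, hS'⟩ := Finset.exists_subsuperset_card_eq S.subset_univ hSR
    (by simp [hR])
  let e : Fin R ≃ S' := (S'.equivFinOfCardEq hS').symm
  refine ⟨D.submatrix id fun r => e r, A.submatrix (fun r => e r) id, ?_, fun r => hAM (e r)⟩
  ext l j
  rw [Matrix.mul_apply]
  simp only [Matrix.submatrix_apply, id_eq]
  rw [e.sum_comp fun i : S' => D l i * A i j, Finset.sum_coe_sort S' fun i => D l i * A i j,
    Finset.sum_subset S'.subset_univ fun i _ hi => by rw [hA0 i (fun h => hi (hSS' h)), mul_zero]]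
  exact congrFun₂ hDA l j
end

section
/- Let F be a field and let K, L, M be positive integers with M < K and L < ⌊K/(K−M)⌋. Then there exist L+1 subsets 𝓜_1, …, 𝓜_{L+1} of {1,…,K}, each of cardinality at most M and depending only on K, L, M, such that for every matrix D ∈ F^{L×K} there exist C ∈ F^{L×(L+1)} and A ∈ F^{(L+1)×K} with D = C·A and with the support of the n-th row of A contained in 𝓜_n for every n ∈ {1,…,L+1}. (Theorem 2, first part: the rate L+1 is achievable with N = L+1 servers under a task assignment independent of the demand matrix.) -/
/-- In `Fin K`, the complement of a full block of length `d` has at most `K - d` elements. -/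
theorem card_filter_div_ne_le {K d n : ℕ} (hd : 0 < d) (h : (n + 1) * d ≤ K) :
    (Finset.univ.filter fun j : Fin K => (j : ℕ) / d ≠ n).card ≤ K - d := by
  have hblock : d ≤ (Finset.univ.filter fun j : Fin K => (j : ℕ) / d = n).card := by
    have hlt (i : Fin d) : n * d + i < K := by
      have := i.isLt
      rw [add_mul] at h
      omega
    rw [← Finset.card_fin d]
    refine Finset.card_le_card_of_injOn (fun i => ⟨n * d + i, hlt i⟩) ?_ ?_
    · intro i _
      simp [mul_comm n d, Nat.mul_add_div hd, Nat.div_eq_of_lt i.isLt]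
    · intro i _ i' _ hi
      simpa [Fin.ext_iff] using hi
  have hsum := Finset.card_filter_add_card_filter_not (s := Finset.univ)
    (fun j : Fin K => (j : ℕ) / d = n)
  rw [Finset.card_univ, Fintype.card_fin] at hsum
  simp only [ne_eq]
  omega


/-- Theorem 2, first part: If `M < K` and `L < ⌊K/(K−M)⌋`, there
exist `L+1` task-assignment sets `𝓜₁, …, 𝓜_{L+1} ⊆ {1,…,K}` of size at most
`M`, independent of the demand matrix, such that every `D ∈ F^{L×K}` factors
as `D = C·A` with the `n`-th row of `A` supported inside `𝓜_n`. -/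
theorem scheme2_rate_Lplus1_achievable
    (F : Type*) [Field F] (K L M : ℕ)
    (hK : 0 < K) (hL : 0 < L) (hM : 0 < M)
    (hMK : M < K) (hLN : L < K / (K - M)) :
    ∃ 𝓜 : Fin (L + 1) → Finset (Fin K),
      (∀ n, (𝓜 n).card ≤ M) ∧
      ∀ D : Matrix (Fin L) (Fin K) F,
        ∃ (C : Matrix (Fin L) (Fin (L + 1)) F) (A : Matrix (Fin (L + 1)) (Fin K) F),
          D = C * A ∧
          ∀ (n : Fin (L + 1)) (j : Fin K), A n j ≠ 0 → j ∈ 𝓜 n := by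
  have hd : 0 < K - M := Nat.sub_pos_of_lt hMK
  have hblocks : (L + 1) * (K - M) ≤ K := (Nat.le_div_iff_mul_le hd).mp hLN
  refine ⟨fun n => Finset.univ.filter fun j => (j : ℕ) / (K - M) ≠ n, fun n => ?_, fun D => ?_⟩
  · have hn : ((n : ℕ) + 1) * (K - M) ≤ K :=
      (Nat.mul_le_mul_right _ (by omega)).trans hblocks
    exact (card_filter_div_ne_le hd hn).trans (by omega)
  · let e (k : ℕ) (j : Fin K) : F := if h : k < L then D ⟨k, h⟩ j else 0
    refine ⟨.of fun i n => (if n = i.castSucc then 1 else 0) - (if n = Fin.last L then 1 else 0),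
      .of fun n j => e n j - e (j / (K - M)) j, ?_, fun n j hA => ?_⟩
    · ext i j
      simp [Matrix.mul_apply, sub_mul, Finset.sum_sub_distrib, e]
    · rw [Finset.mem_filter]
      refine ⟨Finset.mem_univ j, fun hj => hA ?_⟩
      simp [hj]
end

section
/- Let F_q be a finite field with q elements and let K, L, M, R be positive integers with M ≤ K. Suppose that every matrix D ∈ F_q^{L×K} admits a factorization D = C·A for some C ∈ F_q^{L×R} and A ∈ F_q^{R×K} in which every row of A has at most M nonzero entries. Then q^{LK} ≤ C(K,M)^R · q^{R(M+L)}, where C(K,M) is the binomial coefficient 'K choose M'; equivalently, as an inequality of real numbers, R ≥ L·K / (L + M + log_q C(K,M)). (Theorem 3: the optimal rate of the (K,L,M) distributed linearly separable function computation problem satisfies R*(K,L,M) ≥ max(L, LK/(L+M+log_q binom(K,M))).) -/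
/-- The vectors over `ι` with at most `M` nonzero entries number at most
`binom(|ι|, M) · |F|^M`. -/
theorem card_sparse_le {ι F : Type*} [Fintype ι] [DecidableEq ι] [Fintype F] [DecidableEq F]
    [Zero F] {M : ℕ} (hM : M ≤ Fintype.card ι) :
    Fintype.card {v : ι → F // (Finset.univ.filter fun j => v j ≠ 0).card ≤ M} ≤
      (Fintype.card ι).choose M * Fintype.card F ^ M := by
  let extend : (Σ S : {S : Finset ι // S ∈ Finset.powersetCard M Finset.univ}, S.1 → F) → ι → F :=
    fun p j => if h : j ∈ p.1.1 then p.2 ⟨j, h⟩ else 0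
  have hext : ∀ v : {v : ι → F // (Finset.univ.filter fun j => v j ≠ 0).card ≤ M},
      ∃ p, extend p = v.1 := by
    rintro ⟨v, hv⟩
    obtain ⟨S, hvS, -, hS⟩ := Finset.exists_subsuperset_card_eq (Finset.subset_univ _) hv
      (by simpa using hM)
    refine ⟨⟨⟨S, by simp [hS]⟩, fun j => v j⟩, funext fun j => ?_⟩
    by_cases hj : j ∈ S
    · simp [extend, hj]
    · have : v j = 0 := by
        by_contra hne
        exact hj (hvS (by simpa using hne))
      simp [extend, hj, this]
  choose restrict hrestrict using hext
  have hinj : Function.Injective restrict := fun v w h =>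
    Subtype.ext (by rw [← hrestrict v, ← hrestrict w, h])
  refine (Fintype.card_le_of_injective restrict hinj).trans_eq ?_
  have hcard : ∀ S : {S : Finset ι // S ∈ Finset.powersetCard M Finset.univ},
      Fintype.card (S.1 → F) = Fintype.card F ^ M := fun S => by
    simp [(Finset.mem_powersetCard.1 S.2).2]
  rw [Fintype.card_sigma, Finset.sum_congr rfl fun S _ => hcard S]
  simp

/-- If every matrix is a product through inner dimension `R` whose right factor has `M`-sparse
rows, then there are at least as many such pairs of factors as matrices. -/
theorem card_pow_le_of_forall_eq_mul_sparse {m n r F : Type*} [Fintype m] [Fintype n] [Fintype r]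
    [DecidableEq n] [Fintype F] [DecidableEq F] [NonUnitalNonAssocSemiring F]
    {M : ℕ} (hM : M ≤ Fintype.card n)
    (h : ∀ D : Matrix m n F, ∃ (C : Matrix m r F) (A : Matrix r n F), D = C * A ∧
      ∀ i, (Finset.univ.filter fun j => A i j ≠ 0).card ≤ M) :
    Fintype.card F ^ (Fintype.card m * Fintype.card n) ≤
      (Fintype.card n).choose M ^ Fintype.card r *
        Fintype.card F ^ (Fintype.card r * (M + Fintype.card m)) := by
  classical
  let product : (m → r → F) ×
      (r → {v : n → F // (Finset.univ.filter fun j => v j ≠ 0).card ≤ M}) → m → n → F :=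
    fun p => Matrix.of p.1 * Matrix.of fun i => (p.2 i).1
  have hsurj : Function.Surjective product := fun D => by
    obtain ⟨C, A, hD, hA⟩ := h D
    exact ⟨(C, fun i => ⟨A i, hA i⟩), hD.symm⟩
  have hcard := Fintype.card_le_of_surjective product hsurj
  simp only [Fintype.card_prod, Fintype.card_fun] at hcard
  calc Fintype.card F ^ (Fintype.card m * Fintype.card n)
      = (Fintype.card F ^ Fintype.card n) ^ Fintype.card m := by rw [← pow_mul, mul_comm]
    _ ≤ _ := hcard
    _ ≤ (Fintype.card F ^ Fintype.card r) ^ Fintype.card m *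
          ((Fintype.card n).choose M * Fintype.card F ^ M) ^ Fintype.card r := by
        gcongr
        exact card_sparse_le hM
    _ = _ := by ring


/-- Theorem 3, converse: If every `D ∈ F_q^{L×K}` admits a
factorization `D = C·A` with inner dimension `R` and `M`-sparse rows of `A`,
then `q^{LK} ≤ binom(K,M)^R · q^{R(M+L)}`; equivalently,
`R ≥ LK/(L+M+log_q binom(K,M))`. -/
theorem converse_counting_inequality
    (F : Type*) [Field F] [Fintype F] [DecidableEq F]
    (q K L M R : ℕ) (hq : q = Fintype.card F)
    (hK : 0 < K) (hL : 0 < L) (hM : 0 < M) (hR : 0 < R) (hMK : M ≤ K)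
    (hach : ∀ D : Matrix (Fin L) (Fin K) F,
      ∃ (C : Matrix (Fin L) (Fin R) F) (A : Matrix (Fin R) (Fin K) F),
        D = C * A ∧
        ∀ r : Fin R, (Finset.univ.filter fun j : Fin K => A r j ≠ 0).card ≤ M) :
    q ^ (L * K) ≤ (K.choose M) ^ R * q ^ (R * (M + L)) ∧
    (L * K : ℝ) / (L + M + Real.logb q (K.choose M)) ≤ R := by
  subst hq
  have hcount : Fintype.card F ^ (L * K) ≤
      K.choose M ^ R * Fintype.card F ^ (R * (M + L)) := by
    simpa using card_pow_le_of_forall_eq_mul_sparse (by simpa using hMK) hach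
  refine ⟨hcount, ?_⟩
  have hq : (1 : ℝ) < Fintype.card F := by exact_mod_cast Fintype.one_lt_card
  have hchoose : (1 : ℝ) ≤ K.choose M := by exact_mod_cast Nat.choose_pos hMK
  have hlog := Real.logb_nonneg hq hchoose
  have hLpos : (0 : ℝ) < L := by exact_mod_cast hL
  rw [div_le_iff₀ (by positivity)]
  have hreal : (Fintype.card F : ℝ) ^ (L * K) ≤
      (K.choose M : ℝ) ^ R * (Fintype.card F : ℝ) ^ (R * (M + L)) := by exact_mod_cast hcount
  have hle := Real.logb_le_logb_of_le hq (by positivity) hreal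
  rw [Real.logb_mul (by positivity) (by positivity), Real.logb_pow, Real.logb_pow, Real.logb_pow,
    Real.logb_self_eq_one hq] at hle
  push_cast at hle
  linarith
end

section
/- Let F be a field and let D ∈ F^{L×K} be a matrix with the property that for every subset T ⊆ {1,…,K} with |T| ≤ L, the columns of D indexed by T are linearly independent. Suppose D = C·A for some C ∈ F^{L×R} and A ∈ F^{R×K}. Then for every subset T ⊆ {1,…,K} with |T| ≤ L, the number of indices r ∈ {1,…,R} such that the r-th row of A has a nonzero entry in some column j ∈ T is at least |T|. (In the terminology of the paper: the supports 𝓜_r of the rows of A form the blocks of a (K, M, L) multi-level covering design whenever every row of A has at most M nonzero entries.) -/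
/-- core of Theorem 5 / thmcovering: If every set of at most `L`
columns of `D ∈ F^{L×K}` is linearly independent and `D = C·A`, then for every
`T ⊆ {1,…,K}` with `|T| ≤ L`, at least `|T|` rows of `A` have a nonzero entry
in some column of `T` (the row supports form a multi-level covering design). -/
theorem factorization_induces_multilevel_covering
    (F : Type*) [Field F] (L K R : ℕ)
    (D : Matrix (Fin L) (Fin K) F)
    (hcols : ∀ T : Finset (Fin K), T.card ≤ L →
      LinearIndependent F (fun t : {x // x ∈ T} => fun i : Fin L => D i t.val))
    (C : Matrix (Fin L) (Fin R) F) (A : Matrix (Fin R) (Fin K) F)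
    (hfact : D = C * A) :
    ∀ T : Finset (Fin K), T.card ≤ L →
      T.card ≤ Nat.card {r : Fin R | ∃ j ∈ T, A r j ≠ 0} := by
  classical
  intro T hT
  let S : Set (Fin R) := {r | ∃ j ∈ T, A r j ≠ 0}
  let f := (C.submatrix id (Subtype.val : S → Fin R)).mulVecLin
  have hf : (f ∘ fun (t : {x // x ∈ T}) (s : S) => A s t) = fun (t : {x // x ∈ T}) i => D i t := by
    funext t i
    simp only [f, Function.comp_apply, Matrix.mulVecLin_apply, Matrix.mulVec, dotProduct,
      Matrix.submatrix_apply, id_eq, hfact, Matrix.mul_apply]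
    rw [← Fintype.sum_subtype_add_sum_subtype (· ∈ S), left_eq_add]
    refine Finset.sum_eq_zero fun r _ => ?_
    have hr : A r t = 0 := by
      by_contra h
      exact r.2 ⟨t, t.2, h⟩
    rw [hr, mul_zero]
  have hind : LinearIndependent F (fun (t : {x // x ∈ T}) (s : S) => A s t) :=
    LinearIndependent.of_comp f (hf ▸ hcols T hT)
  simpa [S, Nat.card_eq_fintype_card] using hind.fintype_card_le_finrank
end

section
/- Let K, M, Ω be positive integers and let 𝓑_1, …, 𝓑_Ω be subsets of {1,…,K} (repetitions allowed) with |𝓑_ω| ≤ M for every ω. Suppose that every point k ∈ {1,…,K} belongs to at least one block, and that for every pair of distinct points k_1, k_2 ∈ {1,…,K}, the number of indices ω with 𝓑_ω ∩ {k_1,k_2} ≠ ∅ is at least 2. Then Ω·(M+1) ≥ 2K. (Consequently the multi-level covering number satisfies C(K, M, 2) ≥ 2K/(M+1).) -/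
/-- converse half of Theorem 6 / thm4: For blocks
`𝓑₁, …, 𝓑_Ω ⊆ {1,…,K}` of size at most `M` such that every point is covered
and every pair of distinct points intersects at least two blocks,
`Ω(M+1) ≥ 2K`. -/
theorem multilevel_covering_number_L2_lower_bound
    (K M Ω : ℕ) (hK : 0 < K) (hM : 0 < M) (hΩ : 0 < Ω)
    (B : Fin Ω → Finset (Fin K))
    (hsize : ∀ ω, (B ω).card ≤ M)
    (hcover : ∀ k : Fin K, ∃ ω, k ∈ B ω)
    (hpair : ∀ k₁ k₂ : Fin K, k₁ ≠ k₂ →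
      2 ≤ (Finset.univ.filter fun ω : Fin Ω => k₁ ∈ B ω ∨ k₂ ∈ B ω).card) :
    2 * K ≤ Ω * (M + 1) := by
  choose f hf using hcover
  let deg : Fin K → ℕ := fun k => (Finset.univ.filter fun ω => k ∈ B ω).card
  let S : Finset (Fin K) := Finset.univ.filter fun k => deg k ≤ 1
  have hunique : ∀ k ∈ S, ∀ ω, k ∈ B ω → ω = f k := by
    intro k hk ω hω
    exact Finset.card_le_one.mp (Finset.mem_filter.mp hk).2 ω (by simpa using hω) (f k)
      (by simpa using hf k)
  have hS : S.card ≤ Ω := by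
    have hinj : Set.InjOn f S := by
      intro k₁ h₁ k₂ h₂ h
      by_contra hne
      have hsub : (Finset.univ.filter fun ω : Fin Ω => k₁ ∈ B ω ∨ k₂ ∈ B ω) ⊆ {f k₁} := by
        intro ω hω
        rw [Finset.mem_singleton]
        rcases (Finset.mem_filter.mp hω).2 with hω | hω
        · exact hunique k₁ h₁ ω hω
        · exact (hunique k₂ h₂ ω hω).trans h.symm
      have hle := (hpair k₁ k₂ hne).trans (Finset.card_le_card hsub)
      simp at hle
    simpa using Finset.card_le_card_of_injOn f (fun _ _ => Finset.mem_univ _) hinj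
  have hdeg : ∑ k, deg k ≤ Ω * M := by
    have hcount : ∑ k, deg k = ∑ ω, (B ω).card := by
      simp only [deg, Finset.card_filter]
      rw [Finset.sum_comm]
      simp
    rw [hcount]
    simpa using Finset.sum_le_sum fun ω (_ : ω ∈ Finset.univ) => hsize ω
  have hlow : 2 * K ≤ ∑ k, deg k + S.card := by
    have hpoint : ∀ k, 2 ≤ deg k + if deg k ≤ 1 then 1 else 0 := by
      intro k
      have hpos : 0 < deg k := Finset.card_pos.mpr ⟨f k, by simpa using hf k⟩
      split_ifs <;> omega
    have hsum := Finset.sum_le_sum fun k (_ : k ∈ Finset.univ) => hpoint k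
    rw [Finset.sum_add_distrib, ← Finset.card_filter] at hsum
    simpa [mul_comm] using hsum
  rw [mul_add, mul_one]
  omega
end

section
/- Let K, M, Ω be positive integers and let 𝓑_1, …, 𝓑_Ω be subsets of {1,…,K} with |𝓑_ω| ≤ M for every ω, such that every point of {1,…,K} belongs to at least one block and every pair of distinct points intersects at least 2 blocks (in the sense that for k_1 ≠ k_2, |{ω : 𝓑_ω ∩ {k_1,k_2} ≠ ∅}| ≥ 2). Let κ_1 denote the number of points of {1,…,K} that belong to exactly one block. Then: (a) no two points counted by κ_1 lie in the same block, so Ω ≥ κ_1; and (b) κ_1 ≥ 2K − M·Ω. -/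
/-- Double counting of incidences: the degrees of the points add up to the block sizes. -/
lemma sum_card_filter_mem_eq_sum_card {ι α : Type*} [Fintype ι] [Fintype α] [DecidableEq α]
    (B : ι → Finset α) :
    ∑ k, (Finset.univ.filter fun ω => k ∈ B ω).card = ∑ ω, (B ω).card := by
  have h := Finset.sum_card_bipartiteAbove_eq_sum_card_bipartiteBelow
    (s := (Finset.univ : Finset α)) (t := (Finset.univ : Finset ι)) (fun k ω => k ∈ B ω)
  simpa [Finset.bipartiteAbove, Finset.bipartiteBelow] using h

/-- Two points of degree one lying in a common block meet only that block. -/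
lemma card_filter_mem_or_mem_eq_one {ι α : Type*} [Fintype ι] [DecidableEq α]
    {B : ι → Finset α} {k₁ k₂ : α} {ω : ι}
    (h₁ : (Finset.univ.filter fun ω => k₁ ∈ B ω).card = 1)
    (h₂ : (Finset.univ.filter fun ω => k₂ ∈ B ω).card = 1)
    (hω₁ : k₁ ∈ B ω) (hω₂ : k₂ ∈ B ω) :
    (Finset.univ.filter fun ω => k₁ ∈ B ω ∨ k₂ ∈ B ω).card = 1 := by
  have u₁ := Finset.card_le_one.mp h₁.le
  have u₂ := Finset.card_le_one.mp h₂.le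
  simp only [Finset.mem_filter, Finset.mem_univ, true_and] at u₁ u₂
  refine Finset.card_eq_one.mpr ⟨ω, Finset.ext fun ω' => ?_⟩
  simp only [Finset.mem_filter, Finset.mem_univ, true_and, Finset.mem_singleton]
  constructor
  · rintro (h | h)
    · exact u₁ _ h _ hω₁
    · exact u₂ _ h _ hω₂
  · rintro rfl
    exact Or.inl hω₁

/-- counting steps in the proof of Theorem 6 / thm4: with
`κ₁` the number of points lying in exactly one block: (a) two distinct such
points never share a block, hence `Ω ≥ κ₁`; (b) `κ₁ ≥ 2K − MΩ`. -/
theorem covering_design_counting_steps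
    (K M Ω : ℕ) (hK : 0 < K) (hM : 0 < M) (hΩ : 0 < Ω)
    (B : Fin Ω → Finset (Fin K))
    (hsize : ∀ ω, (B ω).card ≤ M)
    (hcover : ∀ k : Fin K, ∃ ω, k ∈ B ω)
    (hpair : ∀ k₁ k₂ : Fin K, k₁ ≠ k₂ →
      2 ≤ (Finset.univ.filter fun ω : Fin Ω => k₁ ∈ B ω ∨ k₂ ∈ B ω).card)
    (κ₁ : ℕ)
    (hκ₁ : κ₁ = (Finset.univ.filter fun k : Fin K =>
      (Finset.univ.filter fun ω : Fin Ω => k ∈ B ω).card = 1).card) :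
    ((∀ k₁ k₂ : Fin K, k₁ ≠ k₂ →
        (Finset.univ.filter fun ω : Fin Ω => k₁ ∈ B ω).card = 1 →
        (Finset.univ.filter fun ω : Fin Ω => k₂ ∈ B ω).card = 1 →
        ¬ ∃ ω, k₁ ∈ B ω ∧ k₂ ∈ B ω) ∧
      κ₁ ≤ Ω) ∧
    (2 * K - M * Ω : ℤ) ≤ (κ₁ : ℤ) := by
  have hdisj : ∀ k₁ k₂ : Fin K, k₁ ≠ k₂ →
      (Finset.univ.filter fun ω : Fin Ω => k₁ ∈ B ω).card = 1 →
      (Finset.univ.filter fun ω : Fin Ω => k₂ ∈ B ω).card = 1 →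
      ¬ ∃ ω, k₁ ∈ B ω ∧ k₂ ∈ B ω := by
    rintro k₁ k₂ hne h₁ h₂ ⟨ω, hω₁, hω₂⟩
    have := hpair k₁ k₂ hne
    rw [card_filter_mem_or_mem_eq_one h₁ h₂ hω₁ hω₂] at this
    omega
  refine ⟨⟨hdisj, ?_⟩, ?_⟩
  · choose f hf using hcover
    rw [hκ₁]
    refine (Finset.card_le_card_of_injOn f (fun _ _ => Finset.mem_univ _) ?_).trans_eq
      (Finset.card_fin Ω)
    intro k₁ h₁ k₂ h₂ heq
    simp only [Finset.coe_filter, Finset.mem_univ, true_and, Set.mem_ofPred_eq] at h₁ h₂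
    by_contra hne
    exact hdisj k₁ k₂ hne h₁ h₂ ⟨f k₁, hf k₁, heq ▸ hf k₂⟩
  · have hdeg : ∀ k : Fin K, 2 ≤ (Finset.univ.filter fun ω : Fin Ω => k ∈ B ω).card +
        if (Finset.univ.filter fun ω : Fin Ω => k ∈ B ω).card = 1 then 1 else 0 := by
      intro k
      obtain ⟨ω, hω⟩ := hcover k
      have hpos : 0 < (Finset.univ.filter fun ω : Fin Ω => k ∈ B ω).card :=
        Finset.card_pos.mpr ⟨ω, by simpa using hω⟩
      split_ifs <;> omega
    have hlow := Finset.sum_le_sum fun k (_ : k ∈ Finset.univ) => hdeg k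
    rw [Finset.sum_add_distrib, sum_card_filter_mem_eq_sum_card, ← Finset.card_filter, ← hκ₁,
      Finset.sum_const, Finset.card_univ, Fintype.card_fin, smul_eq_mul] at hlow
    have hup : ∑ ω, (B ω).card ≤ Ω * M := by
      simpa using Finset.sum_le_card_nsmul Finset.univ (fun ω => (B ω).card) M fun ω _ => hsize ω
    have hmain : K * 2 ≤ Ω * M + κ₁ := by omega
    zify at hmain
    linarith
end

section
/- Let F be a field, let K, M be positive integers with M < K and (M+1) dividing K, and let D ∈ F^{2×K} be a matrix such that every pair of distinct columns of D is linearly independent. Then the minimum R for which there exist C ∈ F^{2×R} and A ∈ F^{R×K} with D = C·A and every row of A having at most M nonzero entries equals 2K/(M+1). (Theorem 6 / thm4: for the (K, L=2, M) distributed linearly separable function computation problem with (M+1) | K, the optimal rate is R*(K, 2, M) = 2K/(M+1).) -/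
open Finset

/-- If the columns of `C * A` are pairwise linearly independent and the rows of `A` have at most
`M` nonzero entries, then double counting the nonzero entries of `A` bounds the number of rows:
a column of `A` has at least one nonzero entry, and each row holds the only nonzero entry of at most
one column. -/
theorem two_mul_card_le_of_mul_sparse {F ι ρ κ : Type*} [Field F] [DecidableEq F]
    [Fintype ρ] [Fintype κ] [Nontrivial κ] (C : Matrix ι ρ F) (A : Matrix ρ κ F) (M : ℕ)
    (hcols : ∀ j₁ j₂ : κ, j₁ ≠ j₂ →
      LinearIndependent F ![fun i => (C * A) i j₁, fun i => (C * A) i j₂])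
    (hA : ∀ r, #{j | A r j ≠ 0} ≤ M) :
    2 * Fintype.card κ ≤ Fintype.card ρ * (M + 1) := by
  classical
  have hpos (j : κ) : 1 ≤ #{r | A r j ≠ 0} := by
    rw [Nat.one_le_iff_ne_zero, Ne, card_eq_zero, filter_eq_empty_iff]
    intro h
    obtain ⟨k, hk⟩ := exists_ne j
    refine (hcols j k hk.symm).ne_zero 0 ?_
    ext i
    simp only [mem_univ, ne_eq, not_not, forall_const] at h
    simp [Matrix.mul_apply, h]
  have hsingle : #{j | #{r | A r j ≠ 0} = 1} ≤ Fintype.card ρ := by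
    have hex (j : κ) : ∃ r, #{r | A r j ≠ 0} = 1 → ∀ s, A s j ≠ 0 ↔ s = r := by
      obtain ⟨r, -⟩ := card_pos.mp (hpos j)
      by_cases h : #{r | A r j ≠ 0} = 1
      · obtain ⟨r, hr⟩ := card_eq_one.mp h
        exact ⟨r, fun _ s => by simpa using congrArg (s ∈ ·) hr⟩
      · exact ⟨r, fun h' => absurd h' h⟩
    choose f hf using hex
    refine card_le_card_of_injOn (t := univ) f (fun _ _ => mem_univ _) ?_
    intro j hj k hk hjk
    by_contra hne
    replace hj := hf j (mem_filter.mp hj).2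
    replace hk := hf k (mem_filter.mp hk).2
    have hcol {l : κ} (hl : ∀ s, A s l ≠ 0 ↔ s = f l) (i : ι) :
        (C * A) i l = C i (f l) * A (f l) l := by
      rw [Matrix.mul_apply]
      refine sum_eq_single _ (fun s _ hs => ?_) (by simp)
      rw [not_not.mp (mt (hl s).mp hs), mul_zero]
    have hzero := LinearIndependent.pair_iff.mp (hcols j k hne) (A (f k) k) (-A (f j) j) (by
      ext i
      simp only [Pi.add_apply, Pi.smul_apply, smul_eq_mul, hcol hj, hcol hk, hjk, Pi.zero_apply]
      ring)
    exact (hk (f k)).mpr rfl hzero.1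
  have hcount : ∑ j, #{r | A r j ≠ 0} = ∑ r, #{j | A r j ≠ 0} := by
    simp only [card_filter]
    exact sum_comm
  have hrows : ∑ r, #{j | A r j ≠ 0} ≤ Fintype.card ρ * M := by
    simpa using sum_le_sum fun r (_ : r ∈ univ) => hA r
  have htwo : 2 * Fintype.card κ ≤
      ∑ j, (#{r | A r j ≠ 0} + if #{r | A r j ≠ 0} = 1 then 1 else 0) := by
    have h := sum_le_sum fun j (_ : j ∈ (univ : Finset κ)) =>
      show 2 ≤ #{r | A r j ≠ 0} + if #{r | A r j ≠ 0} = 1 then 1 else 0 by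
        have := hpos j
        split_ifs <;> omega
    simpa [mul_comm] using h
  rw [sum_add_distrib, ← card_filter] at htwo
  linarith

/-- Every vector of a plane is a combination of two independent vectors `v 0`, `v 1`, with
coefficients that are chosen to be the trivial ones if the vector is itself `v 0` or `v 1`. -/
theorem exists_coeff_of_linearIndependent_pair {F : Type*} [Field F] {m : ℕ}
    (v : Fin (m + 2) → Fin 2 → F) (hv : LinearIndependent F ![v 0, v 1]) (t : Fin (m + 2)) :
    ∃ x : Fin 2 → F, v t = x 0 • v 0 + x 1 • v 1 ∧ (t = 1 → x 0 = 0) ∧ (t = 0 → x 1 = 0) := by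
  rcases eq_or_ne t 0 with rfl | h0
  · exact ⟨![1, 0], by simp, by simp, by simp⟩
  rcases eq_or_ne t 1 with rfl | h1
  · exact ⟨![0, 1], by simp, by simp, by simp⟩
  have hspan := hv.span_eq_top_of_card_eq_finrank (by simp)
  have hmem : v t ∈ Submodule.span F {v 0, v 1} := by
    rw [← Matrix.range_cons_cons_empty (v 0) (v 1) ![], hspan]
    trivial
  obtain ⟨a, b, hab⟩ := Submodule.mem_span_pair.mp hmem
  exact ⟨![a, b], by simp [hab], by simp [h1], by simp [h0]⟩

/-- A matrix with two rows whose columns come in blocks of `m + 2`, the first two columns of each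
block being independent, factors through two rows per block, each with at most `m + 1` nonzero
entries. -/
theorem exists_sparse_factorization_of_blocks {F β : Type*} [Field F] [DecidableEq F]
    [Fintype β] {m : ℕ} (D : Matrix (Fin 2) (β × Fin (m + 2)) F)
    (hD : ∀ b, LinearIndependent F ![fun i => D i (b, 0), fun i => D i (b, 1)]) :
    ∃ (C : Matrix (Fin 2) (β × Fin 2) F) (A : Matrix (β × Fin 2) (β × Fin (m + 2)) F),
      D = C * A ∧ ∀ r, #{j | A r j ≠ 0} ≤ m + 1 := by
  classical
  choose x hx hx0 hx1 using fun b =>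
    exists_coeff_of_linearIndependent_pair (fun t i => D i (b, t)) (hD b)
  refine ⟨.of fun i r => D i (r.1, ![0, 1] r.2),
    .of fun r j => if r.1 = j.1 then x j.1 j.2 r.2 else 0, ?_, ?_⟩
  · ext i ⟨b, t⟩
    have h := congrFun (hx b t) i
    simp only [Pi.add_apply, Pi.smul_apply, smul_eq_mul] at h
    simp [Matrix.mul_apply, Fintype.sum_prod_type, h, mul_comm]
  · rintro ⟨b, s⟩
    have hsub : ({j : β × Fin (m + 2) | (if b = j.1 then x j.1 j.2 s else 0) ≠ 0} : Finset _) ⊆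
        (univ.erase (![1, 0] s)).image (Prod.mk b) := by
      rintro ⟨c, t⟩ h
      simp only [mem_filter, mem_univ, true_and, ne_eq, ite_eq_right_iff, Classical.not_imp] at h
      obtain ⟨rfl, h⟩ := h
      refine mem_image_of_mem _ (mem_erase.mpr ⟨?_, mem_univ _⟩)
      fin_cases s
      · exact fun ht => h (hx0 b t ht)
      · exact fun ht => h (hx1 b t ht)
    refine (card_le_card hsub).trans (card_image_le.trans ?_)
    simp

/-- Theorem 6 / thm4: For `M < K` with `(M+1) | K` and a
demand matrix `D ∈ F^{2×K}` whose pairs of distinct columns are linearly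
independent, the minimum inner dimension `R` of a factorization `D = C·A`
with `M`-sparse rows of `A` equals `2K/(M+1)`. -/
theorem optimal_rate_L_eq_two
    (F : Type*) [Field F] [DecidableEq F] (K M : ℕ)
    (hK : 0 < K) (hM : 0 < M) (hMK : M < K) (hdvd : (M + 1) ∣ K)
    (D : Matrix (Fin 2) (Fin K) F)
    (hcols : ∀ j₁ j₂ : Fin K, j₁ ≠ j₂ →
      LinearIndependent F ![fun i : Fin 2 => D i j₁, fun i : Fin 2 => D i j₂]) :
    IsLeast {R : ℕ |
        ∃ (C : Matrix (Fin 2) (Fin R) F) (A : Matrix (Fin R) (Fin K) F),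
          D = C * A ∧
          ∀ r : Fin R, (Finset.univ.filter fun j : Fin K => A r j ≠ 0).card ≤ M}
      (2 * K / (M + 1)) := by
  obtain ⟨n, rfl⟩ := hdvd
  have hR : 2 * ((M + 1) * n) / (M + 1) = n * 2 := by
    rw [mul_left_comm, Nat.mul_div_cancel_left _ M.succ_pos, mul_comm]
  rw [hR]
  constructor
  · obtain ⟨m, rfl⟩ := Nat.exists_eq_succ_of_ne_zero hM.ne'
    let e : Fin n × Fin (m + 2) ≃ Fin ((m + 2) * n) :=
      finProdFinEquiv.trans (finCongr (mul_comm _ _))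
    obtain ⟨C, A, hCA, hA⟩ := exists_sparse_factorization_of_blocks (D.submatrix id e)
      fun b => hcols _ _ (e.injective.ne (by simp))
    refine ⟨C.submatrix id finProdFinEquiv.symm, A.submatrix finProdFinEquiv.symm e.symm, ?_, ?_⟩
    · rw [Matrix.submatrix_mul_equiv, ← hCA]
      ext i j
      simp
    · intro r
      refine le_trans (le_of_eq ?_) (hA (finProdFinEquiv.symm r))
      exact card_equiv e.symm (by simp)
  · rintro R ⟨C, A, rfl, hA⟩
    have : Nontrivial (Fin ((M + 1) * n)) := Fin.nontrivial_iff_two_le.mpr (by omega)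
    have h := two_mul_card_le_of_mul_sparse C A M hcols hA
    simp only [Fintype.card_fin] at h
    refine Nat.le_of_mul_le_mul_right (c := M + 1) ?_ M.succ_pos
    linarith
end

section
/- Let F be a field and let K, L, M, γ be positive integers with γ ≤ L ≤ K and γ ≤ M ≤ K. Set R = L·⌈K/(L+M−γ)⌉ and N = ⌈L/γ⌉·⌈K/(L+M−γ)⌉, and assume R ≤ K. Then for every matrix D ∈ F^{L×K} of rank L there exist subsets 𝓜_1, …, 𝓜_N of {1,…,K}, each of cardinality at most M, and matrices C ∈ F^{L×R} and A ∈ F^{R×K} with D = C·A, such that the support of every row of A is contained in 𝓜_n for some n ∈ {1,…,N}. (Theorem 7 / thm6: for every γ ≤ L, the rate min{K, L⌈K/(L+M−γ)⌉} is achievable using only N^{(γ)} = ⌈L/γ⌉⌈K/(L+M−γ)⌉ servers.) -/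
theorem Fin.card_filter_div_eq_le (n w b : ℕ) (hw : 0 < w) :
    (Finset.univ.filter fun i : Fin n => (i : ℕ) / w = b).card ≤ w := by
  have h : ((Finset.univ.filter fun i : Fin n => (i : ℕ) / w = b).image Fin.val) ⊆
      Finset.Ico (b * w) ((b + 1) * w) := by
    intro x hx
    simp only [Finset.mem_image, Finset.mem_filter, Finset.mem_univ, true_and] at hx
    obtain ⟨i, rfl, rfl⟩ := hx
    exact Finset.mem_Ico.2 ⟨Nat.div_mul_le_self _ _, Nat.lt_mul_of_div_lt (Nat.lt_succ_self _) hw⟩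
  have h₂ := Finset.card_le_card h
  rw [Finset.card_image_of_injective _ Fin.val_injective, Nat.card_Ico, add_mul, one_mul,
    Nat.add_sub_cancel_left] at h₂
  exact h₂

/-- Any family `S` of vectors of length `L` lies in the span of `L` members of the whole family,
chosen so that as few members of `S` as possible are left out. -/
theorem exists_card_eq_forall_mem_span {F : Type*} [Field F] {K L : ℕ} (hLK : L ≤ K)
    (v : Fin K → Fin L → F) (S : Finset (Fin K)) :
    ∃ T : Finset (Fin K), T.card = L ∧ (S \ T).card ≤ S.card - L ∧
      ∀ j ∈ S, v j ∈ Submodule.span F (v '' (T : Set (Fin K))) := by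
  classical
  rcases le_total S.card L with hS | hS
  · obtain ⟨T, hST, -, hT⟩ := Finset.exists_subsuperset_card_eq (Finset.subset_univ S) hS
      (by simpa using hLK)
    refine ⟨T, hT, by simp [Finset.sdiff_eq_empty_iff_subset.2 hST], fun j hj => ?_⟩
    exact Submodule.subset_span ⟨j, hST hj, rfl⟩
  · obtain ⟨b, hbS, -, hspan, hb⟩ := exists_linearIndepOn_extension
      (linearIndepOn_empty F v) (Set.empty_subset (S : Set (Fin K)))
    have hcard : b.toFinset.card ≤ L := by
      have h := LinearIndependent.fintype_card_le_finrank hb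
      rw [Module.finrank_fin_fun] at h
      rwa [Set.toFinset_card]
    obtain ⟨T, hbT, hTS, hT⟩ := Finset.exists_subsuperset_card_eq
      (show b.toFinset ⊆ S from fun x hx => hbS (by simpa using hx)) hcard hS
    refine ⟨T, hT, by rw [Finset.card_sdiff_of_subset hTS, hT], fun j hj => ?_⟩
    refine Submodule.span_mono (Set.image_mono fun x hx => ?_) (hspan ⟨j, hj, rfl⟩)
    exact hbT (by simpa using hx)

/-- The columns of `D` indexed by `S` are combinations of `L` columns of `D`, where each of the `L`
rows of coefficients is supported on its own column and the members of `S` outside the chosen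
columns. -/
theorem exists_columns_coefficients {F : Type*} [Field F] {K L : ℕ} (hLK : L ≤ K)
    (D : Matrix (Fin L) (Fin K) F) (S : Finset (Fin K)) :
    ∃ (p : Fin L → Fin K) (E : Finset (Fin K)) (c : Matrix (Fin L) (Fin K) F),
      E.card ≤ S.card - L ∧
      (∀ j ∈ S, ∀ l, ∑ i, D l (p i) * c i j = D l j) ∧
      (∀ j ∉ S, ∀ i, c i j = 0) ∧
      ∀ i j, c i j ≠ 0 → j = p i ∨ j ∈ E := by
  classical
  obtain ⟨T, hT, hcard, hspan⟩ := exists_card_eq_forall_mem_span hLK (fun j l => D l j) S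
  let p := T.orderEmbOfFin hT
  have hcol : ∀ j, ∃ a : Fin L → F, (j ∈ S → ∀ l, ∑ i, D l (p i) * a i = D l j) ∧
      (j ∉ S → a = 0) ∧ ∀ i, a i ≠ 0 → j = p i ∨ j ∈ S \ T := by
    intro j
    by_cases hjS : j ∈ S
    · by_cases hjT : j ∈ T
      · obtain ⟨i₀, rfl⟩ : j ∈ Set.range p := by
          rw [Finset.range_orderEmbOfFin]; exact hjT
        refine ⟨Pi.single i₀ 1, fun _ l => by simp [Pi.single_apply],
          fun h => absurd hjS h, fun i hi => Or.inl ?_⟩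
        by_contra h
        exact hi (Pi.single_eq_of_ne (fun e => h (by rw [e])) _)
      · have h := hspan j hjS
        rw [← Finset.range_orderEmbOfFin T hT, ← Set.range_comp,
          Submodule.mem_span_range_iff_exists_fun] at h
        obtain ⟨a, ha⟩ := h
        refine ⟨a, fun _ l => ?_, fun h => absurd hjS h,
          fun _ _ => Or.inr (Finset.mem_sdiff.2 ⟨hjS, hjT⟩)⟩
        simpa [Finset.sum_apply, mul_comm] using congrFun ha l
    · exact ⟨0, fun h => absurd h hjS, fun _ => rfl, fun i hi => absurd rfl hi⟩
  choose a ha₁ ha₂ ha₃ using hcol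
  exact ⟨p, S \ T, fun i j => a j i, hcard, ha₁, fun j hj i => congrFun (ha₂ j hj) i,
    fun i j => ha₃ j i⟩

theorem Nat.div_lt_ceil_div {i n w : ℕ} (hw : 0 < w) (hi : i < n) :
    i / w < ⌈(n : ℚ) / w⌉₊ := by
  have hw' : (0 : ℚ) < w := by exact_mod_cast hw
  have h : (n : ℚ) ≤ ⌈(n : ℚ) / w⌉₊ * w := (div_le_iff₀ hw').1 (Nat.le_ceil _)
  have h' : n ≤ ⌈(n : ℚ) / w⌉₊ * w := by exact_mod_cast h
  exact (Nat.div_lt_iff_lt_mul hw).2 (hi.trans_le h')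


/-- Theorem 7 / thm6: For every `γ ≤ L`, with
`R = L·⌈K/(L+M−γ)⌉ ≤ K` and `N = ⌈L/γ⌉·⌈K/(L+M−γ)⌉`, every rank-`L` demand
matrix `D ∈ F^{L×K}` admits a factorization `D = C·A` with `M`-sparse rows of
`A`, all supported inside one of `N` task-assignment sets of size at most `M`. -/
theorem rate_vs_servers_tradeoff
    (F : Type*) [Field F] (K L M γ : ℕ)
    (hγ : 0 < γ) (hγL : γ ≤ L) (hLK : L ≤ K) (hγM : γ ≤ M) (hMK : M ≤ K)
    (R N : ℕ)
    (hRdef : R = L * ⌈(K : ℚ) / (L + M - γ : ℕ)⌉₊)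
    (hNdef : N = ⌈(L : ℚ) / γ⌉₊ * ⌈(K : ℚ) / (L + M - γ : ℕ)⌉₊)
    (hRK : R ≤ K) :
    ∀ D : Matrix (Fin L) (Fin K) F, D.rank = L →
      ∃ 𝓜 : Fin N → Finset (Fin K),
        (∀ n, (𝓜 n).card ≤ M) ∧
        ∃ (C : Matrix (Fin L) (Fin R) F) (A : Matrix (Fin R) (Fin K) F),
          D = C * A ∧
          ∀ r : Fin R, ∃ n : Fin N, ∀ j : Fin K, A r j ≠ 0 → j ∈ 𝓜 n := by
  classical
  intro D _
  have hW : 0 < L + M - γ := by omega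
  have hblock (j : Fin K) := Nat.div_lt_ceil_div hW j.isLt
  have hgroup (i : Fin L) := Nat.div_lt_ceil_div hγ i.isLt
  generalize ⌈(K : ℚ) / (L + M - γ : ℕ)⌉₊ = B at *
  generalize ⌈(L : ℚ) / γ⌉₊ = G at *
  subst hRdef hNdef
  let S : Fin B → Finset (Fin K) := fun b =>
    Finset.univ.filter fun j => (j : ℕ) / (L + M - γ) = b
  have hS (b) : (S b).card ≤ L + M - γ := Fin.card_filter_div_eq_le _ _ _ hW
  choose p E c hE hsum hzero hsupp using fun b => exists_columns_coefficients hLK D (S b)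
  refine ⟨fun n => (Finset.univ.filter fun i : Fin L =>
      (i : ℕ) / γ = (finProdFinEquiv.symm n).1).image (p (finProdFinEquiv.symm n).2) ∪
      E (finProdFinEquiv.symm n).2, fun n => ?_,
    Matrix.of fun l r => D l (p (finProdFinEquiv.symm r).2 (finProdFinEquiv.symm r).1),
    Matrix.of fun r j => c (finProdFinEquiv.symm r).2 (finProdFinEquiv.symm r).1 j, ?_, fun r => ?_⟩
  · beta_reduce
    generalize finProdFinEquiv.symm n = q
    refine (Finset.card_union_le _ _).trans ?_
    have h₁ := (Finset.card_image_le (f := p q.2)).trans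
      (Fin.card_filter_div_eq_le L γ q.1 hγ)
    have h₂ := hE q.2
    have h₃ := hS q.2
    omega
  · ext l j
    simp only [Matrix.mul_apply, Matrix.of_apply]
    rw [Equiv.sum_comp finProdFinEquiv.symm
      (fun q : Fin L × Fin B => D l (p q.2 q.1) * c q.2 q.1 j), Fintype.sum_prod_type_right,
      Finset.sum_eq_single ⟨(j : ℕ) / (L + M - γ), hblock j⟩]
    · exact (hsum _ j (by simp [S]) l).symm
    · intro b _ hb
      refine Finset.sum_eq_zero fun i _ => ?_
      rw [hzero b j (fun hj => hb (Fin.ext (Finset.mem_filter.1 hj).2.symm)) i, mul_zero]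
    · simp
  · obtain ⟨q, rfl⟩ := finProdFinEquiv.surjective r
    refine ⟨finProdFinEquiv (⟨(q.1 : ℕ) / γ, hgroup q.1⟩, q.2), fun j hj => ?_⟩
    simp only [Matrix.of_apply, Equiv.symm_apply_apply] at hj ⊢
    rcases hsupp q.2 q.1 j hj with rfl | h
    · exact Finset.mem_union_left _ (Finset.mem_image_of_mem _ (by simp))
    · exact Finset.mem_union_right _ h
end

section
/- Let K, L, M be positive integers with L ≤ K and M ≤ K, and set R = min( K, L·⌈K/(L+M−1)⌉ ). Then for every matrix D ∈ ℝ^{L×K} there exist matrices C ∈ ℝ^{L×R} and A ∈ ℝ^{R×K} such that D = C·A and every row of A has at most M nonzero entries. (Corollary 1: the achievability result of Theorem 1 remains valid when computation is performed over the field of real numbers.) -/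
open Finset in
/-- A family indexed by a finset `B` in a space of dimension `d` is spanned by a subfamily
with exactly `min d #B` members. -/
theorem exists_subset_card_eq_min_finrank_span {𝕜 V ι : Type*} [Field 𝕜] [AddCommGroup V]
    [Module 𝕜 V] [FiniteDimensional 𝕜 V] (v : ι → V) (B : Finset ι) :
    ∃ S ⊆ B, S.card = min (Module.finrank 𝕜 V) B.card ∧
      ∀ j ∈ B, v j ∈ Submodule.span 𝕜 (v '' (S : Set ι)) := by
  obtain ⟨T, hTB, -, hspan, hT⟩ := exists_linearIndepOn_extension (K := 𝕜) (v := v)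
    (linearIndepOn_empty 𝕜 v) (Set.empty_subset (B : Set ι))
  lift T to Finset ι using B.finite_toSet.subset hTB
  have hTB' : T ⊆ B := by exact_mod_cast hTB
  have hcard : T.card ≤ Module.finrank 𝕜 V := by
    simpa using LinearIndependent.fintype_card_le_finrank hT
  obtain ⟨S, hTS, hSB, hS⟩ := exists_subsuperset_card_eq hTB'
    (le_min hcard (card_le_card hTB')) (min_le_right (Module.finrank 𝕜 V) B.card)
  refine ⟨S, hSB, hS, fun j hj => ?_⟩
  exact Submodule.span_mono (Set.image_mono (by exact_mod_cast hTS))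
    (hspan (Set.mem_image_of_mem v hj))

open Finset in
/-- If the columns of a matrix are combinations of the columns indexed by a finset `T`, and each
column of `T` is used at most `M` times, the matrix factors through any `ρ` with `#T ≤ #ρ`
with at most `M` nonzero entries in every row of the right factor. -/
theorem exists_mul_eq_of_columns_combination {𝕜 m ι ρ : Type*} [Field 𝕜] [DecidableEq 𝕜]
    [Fintype ι] [Fintype ρ] (D : Matrix m ι 𝕜) (T : Finset ι) (c : ι → ι → 𝕜) (M : ℕ)
    (hT : T.card ≤ Fintype.card ρ) (hc : ∀ l j, D l j = ∑ s ∈ T, D l s * c j s)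
    (hM : ∀ s ∈ T, (univ.filter fun j => c j s ≠ 0).card ≤ M) :
    ∃ (C : Matrix m ρ 𝕜) (A : Matrix ρ ι 𝕜), D = C * A ∧
      ∀ r, (univ.filter fun j => A r j ≠ 0).card ≤ M := by
  obtain ⟨f⟩ : Nonempty (T ↪ ρ) := Function.Embedding.nonempty_of_card_le (by simpa using hT)
  refine ⟨.of fun l => Function.extend f (fun s => D l s) 0,
    .of (Function.extend f (fun s j => c j s) 0), ?_, fun r => ?_⟩
  · ext l j
    rw [hc, Matrix.mul_apply, ← sum_coe_sort T]
    refine Fintype.sum_of_injective f f.injective _ _ (fun r hr => ?_) (fun s => ?_)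
    · simp [Function.extend_apply' (f := f) _ _ r hr]
    · simp [f.injective.extend_apply]
  · by_cases hr : ∃ s, f s = r
    · obtain ⟨s, rfl⟩ := hr
      simpa [f.injective.extend_apply] using hM s s.2
    · simp [Function.extend_apply' _ _ _ hr]

open Finset in
/-- If the columns of a matrix with `L` rows are split into `#κ` blocks of at most `L + M - 1`
columns, the matrix factors through any `ρ` with `min #ι (L * #κ) ≤ #ρ`, with at most `M` nonzero
entries in every row of the right factor. -/
theorem exists_mul_eq_of_column_blocks {𝕜 m ι κ ρ : Type*} [Field 𝕜] [DecidableEq 𝕜] [Fintype m]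
    [Fintype ι] [Fintype κ] [DecidableEq κ] [Fintype ρ] (D : Matrix m ι 𝕜) (β : ι → κ) {M : ℕ}
    (hM : 0 < M)
    (hβ : ∀ b, (univ.filter fun j => β j = b).card ≤ Fintype.card m + M - 1)
    (hρ : min (Fintype.card ι) (Fintype.card m * Fintype.card κ) ≤ Fintype.card ρ) :
    ∃ (C : Matrix m ρ 𝕜) (A : Matrix ρ ι 𝕜), D = C * A ∧
      ∀ r, (univ.filter fun j => A r j ≠ 0).card ≤ M := by
  classical
  choose S hSB hS hspan using fun b : κ =>
    exists_subset_card_eq_min_finrank_span (𝕜 := 𝕜) D.col (univ.filter fun j => β j = b)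
  simp only [Module.finrank_fintype_fun_eq_card] at hS
  have hSβ : ∀ {b s}, s ∈ S b → β s = b := fun {b s} hs => by simpa using hSB b hs
  have hcol : ∀ j, ∃ c : ι → 𝕜, (∀ s, c s ≠ 0 → s ∈ S (β j)) ∧
      (j ∈ S (β j) → ∀ s, c s ≠ 0 → s = j) ∧
      ∀ l, D l j = ∑ s ∈ S (β j), D l s * c s := by
    intro j
    by_cases hj : j ∈ S (β j)
    · refine ⟨Pi.single j 1, fun s hs => ?_, fun _ s hs => ?_, fun l => ?_⟩
      · obtain rfl : s = j := by_contra fun h => hs (by simp [h])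
        exact hj
      · exact by_contra fun h => hs (by simp [h])
      · simp [Pi.single_apply, hj]
    · obtain ⟨c, hc⟩ := Submodule.mem_span_image_finset_iff_exists_fun 𝕜 |>.1
        (hspan (β j) j (by simp))
      refine ⟨fun s => if h : s ∈ S (β j) then c ⟨s, h⟩ else 0, fun s hs => ?_,
        fun h => (hj h).elim, fun l => ?_⟩
      · exact by_contra fun h => hs (by simp [h])
      · have := congrFun hc l
        simp only [Finset.sum_apply, Pi.smul_apply, Matrix.col_apply, smul_eq_mul] at this
        rw [← this, ← sum_coe_sort (S (β j))]
        exact sum_congr rfl fun s _ => by simp [mul_comm]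
  choose c hcS hcj hc using hcol
  refine exists_mul_eq_of_columns_combination D (univ.biUnion S) c M ?_ (fun l j => ?_)
    (fun s hs => ?_)
  · refine (le_min (card_le_univ _) ?_).trans hρ
    rw [mul_comm]
    exact card_biUnion_le_card_mul _ _ _ fun b _ => (hS b).trans_le (min_le_left _ _)
  · rw [hc]
    refine sum_subset (subset_biUnion_of_mem S (mem_univ _)) fun s _ hs => ?_
    rw [by_contra fun h => hs (hcS j s h), mul_zero]
  · obtain ⟨b, -, hsb⟩ := mem_biUnion.1 hs
    have hsub : (univ.filter fun j => c j s ≠ 0) ⊆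
        insert s ((univ.filter fun j => β j = b) \ S b) := by
      intro j hj
      have hj : c j s ≠ 0 := by simpa using hj
      have hjb : β j = b := (hSβ (hcS j s hj)).symm.trans (hSβ hsb)
      have := hcj j
      rw [hjb] at this
      by_cases hjS : j ∈ S b
      · simp [this hjS s hj]
      · simp [hjb, hjS]
    have h₁ := (card_le_card hsub).trans (card_insert_le _ _)
    rw [card_sdiff_of_subset (hSB b), hS b] at h₁
    have := hβ b
    omega

/-- Corollary 1: The achievability of Theorem 1 over the reals:
with `R = min(K, L·⌈K/(L+M−1)⌉)`, every `D ∈ ℝ^{L×K}` factors as `D = C·A`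
with every row of `A` having at most `M` nonzero entries. -/
theorem scheme1_rate_achievable_over_reals
    (K L M : ℕ) (hK : 0 < K) (hL : 0 < L) (hM : 0 < M)
    (hLK : L ≤ K) (hMK : M ≤ K)
    (R : ℕ) (hR : R = min K (L * ⌈(K : ℚ) / (L + M - 1 : ℕ)⌉₊)) :
    ∀ D : Matrix (Fin L) (Fin K) ℝ,
      ∃ (C : Matrix (Fin L) (Fin R) ℝ) (A : Matrix (Fin R) (Fin K) ℝ),
        D = C * A ∧
        ∀ r : Fin R, (Finset.univ.filter fun j : Fin K => A r j ≠ 0).card ≤ M := by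
  intro D
  set n := L + M - 1 with hn
  have hn0 : 0 < n := by omega
  have hdiv : ∀ j : Fin K, (j : ℕ) / n < ⌈(K : ℚ) / (n : ℕ)⌉₊ := fun j => by
    rw [Nat.lt_ceil, lt_div_iff₀ (by exact_mod_cast hn0)]
    exact_mod_cast (Nat.div_mul_le_self _ _).trans_lt j.2
  convert exists_mul_eq_of_column_blocks D
    (fun j => (⟨(j : ℕ) / n, hdiv j⟩ : Fin ⌈(K : ℚ) / (n : ℕ)⌉₊)) hM (fun b => ?_)
    (ρ := Fin R) (by simp [hR])
  rw [Fintype.card_fin, ← hn]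
  refine (Finset.card_le_card_of_injOn (t := Finset.range n) (fun j : Fin K => (j : ℕ) % n)
    (fun j _ => by simpa using Nat.mod_lt _ hn0) (fun i hi j hj hij => ?_)).trans_eq
    (Finset.card_range n)
  simp only [Finset.coe_filter, Finset.mem_univ, true_and, Set.mem_ofPred_eq, Fin.ext_iff] at hi hj
  rw [Fin.ext_iff, ← Nat.div_add_mod (i : ℕ) n, ← Nat.div_add_mod (j : ℕ) n, hi, hj]
  exact congrArg _ hij
end

section
/- Let K, L, M be positive integers with L + M − 1 ≤ K. Then min( K, L·⌈K/M⌉ ) ≤ 3 · min( K, L·⌈K/(L+M−1)⌉ ). (Remark 7: the rate R_disjoint(K,L,M) = min{K, L⌈K/M⌉} achieved by the disjoint task assignment is at most three times the rate R_1(K,L,M) = min{K, L⌈K/(L+M−1)⌉} achieved by Scheme 1.) -/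
/-- Remark 7: The disjoint-assignment rate
`min(K, L⌈K/M⌉)` is at most three times Scheme 1's rate
`min(K, L⌈K/(L+M−1)⌉)`. -/
theorem disjoint_rate_within_factor_three
    (K L M : ℕ) (hK : 0 < K) (hL : 0 < L) (hM : 0 < M)
    (hLMK : L + M - 1 ≤ K) :
    min K (L * ⌈(K : ℚ) / (M : ℕ)⌉₊) ≤
      3 * min K (L * ⌈(K : ℚ) / (L + M - 1 : ℕ)⌉₊) := by
  have hN : (0 : ℚ) < (L + M - 1 : ℕ) := by
    have : 0 < L + M - 1 := by omega
    exact_mod_cast this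
  have hM' : (0 : ℚ) < (M : ℕ) := by exact_mod_cast hM
  have hceil := Nat.le_ceil ((K : ℚ) / (L + M - 1 : ℕ))
  generalize ⌈(K : ℚ) / (L + M - 1 : ℕ)⌉₊ = a at hceil ⊢
  rw [div_le_iff₀ hN] at hceil
  have hKa : K ≤ a * (L + M - 1) := by exact_mod_cast hceil
  rw [← Nat.mul_min_mul_left]
  refine le_min ((min_le_left _ _).trans (by omega)) ?_
  rcases le_total (L + M - 1) (3 * L) with h | h
  · refine (min_le_left _ _).trans ?_
    calc K ≤ a * (L + M - 1) := hKa
      _ ≤ a * (3 * L) := Nat.mul_le_mul_left a h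
      _ = 3 * (L * a) := by ring
  · refine (min_le_right _ _).trans ?_
    have hb : ⌈(K : ℚ) / (M : ℕ)⌉₊ ≤ 3 * a := by
      rw [Nat.ceil_le, div_le_iff₀ hM']
      have : K ≤ 3 * a * M := by
        calc K ≤ a * (L + M - 1) := hKa
          _ ≤ a * (3 * M) := Nat.mul_le_mul_left a (by omega)
          _ = 3 * a * M := by ring
      exact_mod_cast this
    calc L * ⌈(K : ℚ) / (M : ℕ)⌉₊ ≤ L * (3 * a) := Nat.mul_le_mul_left L hb
      _ = 3 * (L * a) := by ring
end

section
/- Let F be a field, let K, L, M be positive integers with K = L + M − 1, and let D ∈ F^{L×K} be a matrix of rank L. Then the minimum R for which there exist C ∈ F^{L×R} and A ∈ F^{R×K} with D = C·A and every row of A having at most M nonzero entries equals L. (The achievability is Lemma 1; the converse holds since D = C·A and rank(D) = L force R ≥ L. Hence, for K ≤ L + M − 1, the optimal rate of the (K,L,M) distributed linearly separable function computation problem is exactly L.) -/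
/-- A matrix of full row rank has an invertible square submatrix on all of its rows. -/
theorem Matrix.exists_injective_isUnit_det_submatrix {F : Type*} [Field F] {L : ℕ}
    {n : Type*} [Fintype n] (D : Matrix (Fin L) n F) (hrank : D.rank = L) :
    ∃ f : Fin L → n, Function.Injective f ∧ IsUnit (D.submatrix id f).det := by
  obtain ⟨κ, a, ha, hspan, hli⟩ := exists_linearIndependent' F D.col
  have : Finite κ := Finite.of_injective a ha
  have := Fintype.ofFinite κ
  have hcard : Fintype.card κ = L := by
    rw [← finrank_span_eq_card hli, hspan, ← D.rank_eq_finrank_span_cols, hrank]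
  let e : Fin L ≃ κ := (Fintype.equivFinOfCardEq hcard).symm
  refine ⟨a ∘ e, ha.comp e.injective, ?_⟩
  rw [← Matrix.isUnit_iff_isUnit_det, ← Matrix.linearIndependent_cols_iff_isUnit]
  exact hli.comp e e.injective

/-- For `K = L + M − 1` and any rank-`L` demand matrix
`D ∈ F^{L×K}`, the minimum inner dimension `R` of a factorization `D = C·A`
with `M`-sparse rows of `A` equals `L`. -/
theorem optimal_rate_eq_L_when_K_eq_LplusMminus1
    (F : Type*) [Field F] [DecidableEq F] (K L M : ℕ)
    (hK : 0 < K) (hL : 0 < L) (hM : 0 < M) (hKLM : K = L + M - 1)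
    (D : Matrix (Fin L) (Fin K) F) (hrank : D.rank = L) :
    IsLeast {R : ℕ |
        ∃ (C : Matrix (Fin L) (Fin R) F) (A : Matrix (Fin R) (Fin K) F),
          D = C * A ∧
          ∀ r : Fin R, (Finset.univ.filter fun j : Fin K => A r j ≠ 0).card ≤ M}
      L := by
  constructor
  · obtain ⟨f, hf, hdet⟩ := D.exists_injective_isUnit_det_submatrix hrank
    set S := D.submatrix id f
    refine ⟨S, S⁻¹ * D, (Matrix.mul_nonsing_inv_cancel_left S D hdet).symm, fun r => ?_⟩
    have hone (i : Fin L) : (S⁻¹ * D) r (f i) = (1 : Matrix (Fin L) (Fin L) F) r i := by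
      rw [← Matrix.nonsing_inv_mul S hdet]
      rfl
    have hsub : (Finset.univ.filter fun j : Fin K => (S⁻¹ * D) r j ≠ 0) ⊆
        ((Finset.univ.erase r).image f)ᶜ := by
      intro j hj
      simp only [Finset.mem_filter, Finset.mem_univ, true_and] at hj
      simp only [Finset.mem_compl, Finset.mem_image, Finset.mem_erase, not_exists, not_and]
      rintro i ⟨hi, -⟩ rfl
      exact hj ((hone i).trans (Matrix.one_apply_ne' hi))
    refine (Finset.card_le_card hsub).trans ?_
    rw [Finset.card_compl, Finset.card_image_of_injective _ hf,
      Finset.card_erase_of_mem (Finset.mem_univ r), Finset.card_univ, Fintype.card_fin,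
      Fintype.card_fin]
    omega
  · rintro R ⟨C, A, hD, -⟩
    calc L = (C * A).rank := by rw [← hD, hrank]
      _ ≤ C.rank := Matrix.rank_mul_le_left C A
      _ ≤ R := C.rank_le_width
end
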